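/- arXiv:2007.10821 — 2 statements merged into one kernel-verified Lean document; each statement's English description precedes it below -/
import Mathlib

section
/- Let λ, r, θ, ρ > 0, ξ ∈ (0,1], α > 2, and set δ = 2/α. Define Ψ : (0,1] → ℝ by Ψ(p) = exp( −θ r^α/ρ − λ π r² θ^δ ∫₀^∞ min{ (ξ/p)(1 + u^{−α/2}), 1 } / (1 + u^{α/2}) du ). Then for every p ∈ (0,1] the integral is finite, Ψ maps (0,1] into (0,1), and there exists p* ∈ (0,1) with Ψ(p*) = p*, i.e., the fixed-point equation (10) of Theorem 1 admits a solution. -/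
open MeasureTheory Real

/-- The interference kernel `1 / (1 + u ^ a)` is integrable on the half-line when `a > 1`. -/
theorem integrableOn_Ioi_one_div_one_add_rpow {a : ℝ} (ha : 1 < a) :
    IntegrableOn (fun u : ℝ => 1 / (1 + u ^ a)) (Set.Ioi (0 : ℝ)) := by
  have hm : Measurable fun u : ℝ => 1 / (1 + u ^ a) := by fun_prop
  rw [← Set.Ioc_union_Ioi_eq_Ioi (zero_le_one' ℝ)]
  refine IntegrableOn.union ?_ ?_
  · refine Integrable.mono' (integrableOn_const (C := (1 : ℝ)) (by simp))
      hm.aestronglyMeasurable ?_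
    refine (ae_restrict_iff' measurableSet_Ioc).2 (.of_forall fun u hu => ?_)
    have hpow : 0 < u ^ a := rpow_pos_of_pos hu.1 a
    rw [Real.norm_of_nonneg (by positivity), div_le_one (by positivity)]
    linarith
  · refine Integrable.mono' (integrableOn_Ioi_rpow_of_lt (a := -a) (by linarith) one_pos)
      hm.aestronglyMeasurable ?_
    refine (ae_restrict_iff' measurableSet_Ioi).2 (.of_forall fun u hu => ?_)
    have hu0 : 0 < u := one_pos.trans hu
    have hpow : 0 < u ^ a := rpow_pos_of_pos hu0 a
    rw [Real.norm_of_nonneg (by positivity), rpow_neg hu0.le, ← one_div]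
    exact one_div_le_one_div_of_le hpow (by linarith)

theorem activity_div_nonneg {a c u : ℝ} (hc : 0 ≤ c) (hu : 0 < u) :
    0 ≤ min (c * (1 + u ^ (-a))) 1 / (1 + u ^ a) := by
  have hpow : 0 < u ^ a := rpow_pos_of_pos hu a
  have hneg : 0 < u ^ (-a) := rpow_pos_of_pos hu (-a)
  positivity

theorem activity_div_le {a c u : ℝ} (hu : 0 < u) :
    min (c * (1 + u ^ (-a))) 1 / (1 + u ^ a) ≤ 1 / (1 + u ^ a) := by
  have hpow : 0 < u ^ a := rpow_pos_of_pos hu a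
  gcongr
  exact min_le_right _ _

theorem norm_activity_div_le_ae {a c : ℝ} (hc : 0 ≤ c) :
    ∀ᵐ u ∂volume.restrict (Set.Ioi (0 : ℝ)),
      ‖min (c * (1 + u ^ (-a))) 1 / (1 + u ^ a)‖ ≤ 1 / (1 + u ^ a) := by
  refine (ae_restrict_iff' measurableSet_Ioi).2 (.of_forall fun u hu => ?_)
  rw [Real.norm_of_nonneg (activity_div_nonneg hc hu)]
  exact activity_div_le hu

theorem integrableOn_activity_div {a c : ℝ} (ha : 1 < a) (hc : 0 ≤ c) :
    IntegrableOn (fun u : ℝ => min (c * (1 + u ^ (-a))) 1 / (1 + u ^ a)) (Set.Ioi (0 : ℝ)) :=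
  Integrable.mono' (integrableOn_Ioi_one_div_one_add_rpow ha)
    (Measurable.aestronglyMeasurable (by fun_prop)) (norm_activity_div_le_ae hc)

/-- The interference integral depends continuously on the activity level. -/
theorem continuousOn_integral_activity_div {a : ℝ} (ha : 1 < a) :
    ContinuousOn
      (fun c : ℝ => ∫ u in Set.Ioi (0 : ℝ), min (c * (1 + u ^ (-a))) 1 / (1 + u ^ a))
      (Set.Ici 0) :=
  continuousOn_of_dominated
    (fun _ _ => Measurable.aestronglyMeasurable (by fun_prop))
    (fun _ hc => norm_activity_div_le_ae hc)
    (integrableOn_Ioi_one_div_one_add_rpow ha)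
    (.of_forall fun _ => by fun_prop)

/-- Theorem 1, equation (10): the fixed-point equation
`p = exp(−θ r^α/ρ − λ π r² θ^δ ∫₀^∞ min{(ξ/p)(1+u^{−α/2}), 1}/(1+u^{α/2}) du)`
is well posed (the integral is finite and the map sends `(0,1]` into `(0,1)`)
and admits a solution `p* ∈ (0,1)`. -/
theorem fixed_point_equation_simplified
    (lam r θ ρ : ℝ) (hlam : 0 < lam) (hr : 0 < r) (hθ : 0 < θ) (hρ : 0 < ρ)
    (ξ : ℝ) (hξ : ξ ∈ Set.Ioc (0:ℝ) 1) (α : ℝ) (hα : 2 < α) (δ : ℝ) (hδ : δ = 2 / α)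
    (Ψ : ℝ → ℝ)
    (hΨ : ∀ p : ℝ, Ψ p = Real.exp (-(θ * r ^ α / ρ)
      - lam * π * r ^ 2 * θ ^ δ *
        ∫ u in Set.Ioi (0:ℝ),
          min ((ξ / p) * (1 + u ^ (-(α / 2)))) 1 / (1 + u ^ (α / 2)))) :
    (∀ p ∈ Set.Ioc (0:ℝ) 1,
        IntegrableOn
          (fun u : ℝ => min ((ξ / p) * (1 + u ^ (-(α / 2)))) 1 / (1 + u ^ (α / 2)))
          (Set.Ioi (0:ℝ))) ∧
    (∀ p ∈ Set.Ioc (0:ℝ) 1, Ψ p ∈ Set.Ioo (0:ℝ) 1) ∧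
    (∃ p ∈ Set.Ioo (0:ℝ) 1, Ψ p = p) := by
  have ha : 1 < α / 2 := by linarith
  have hc : ∀ p ∈ Set.Ioc (0 : ℝ) 1, 0 ≤ ξ / p := fun p hp => (div_pos hξ.1 hp.1).le
  have hK : 0 < lam * π * r ^ 2 * θ ^ δ := by positivity
  have hN : 0 < θ * r ^ α / ρ := by positivity
  have hlt : ∀ p ∈ Set.Ioc (0 : ℝ) 1, Ψ p ∈ Set.Ioo (0 : ℝ) 1 := fun p hp => by
    have hI := setIntegral_nonneg (μ := volume) measurableSet_Ioi
      fun u hu => activity_div_nonneg (a := α / 2) (hc p hp) (Set.mem_Ioi.1 hu)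
    rw [hΨ]
    exact ⟨exp_pos _, exp_lt_one_iff.2 (by linarith [mul_nonneg hK.le hI])⟩
  refine ⟨fun p hp => integrableOn_activity_div ha (hc p hp), hlt, ?_⟩
  set m := exp (-(θ * r ^ α / ρ) - lam * π * r ^ 2 * θ ^ δ *
    ∫ u in Set.Ioi (0 : ℝ), 1 / (1 + u ^ (α / 2))) with hm
  have hm0 : 0 < m := exp_pos _
  have hle : ∀ p ∈ Set.Ioc (0 : ℝ) 1, m ≤ Ψ p := fun p hp => by
    rw [hΨ, hm]
    refine exp_le_exp.2 ?_
    refine sub_le_sub_left (mul_le_mul_of_nonneg_left ?_ hK.le) _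
    exact setIntegral_mono_on (integrableOn_activity_div ha (hc p hp))
      (integrableOn_Ioi_one_div_one_add_rpow ha) measurableSet_Ioi
      fun u hu => activity_div_le hu
  have h1 : (1 : ℝ) ∈ Set.Ioc (0 : ℝ) 1 := ⟨one_pos, le_rfl⟩
  have hm1 : m ≤ 1 := (hle 1 h1).trans (hlt 1 h1).2.le
  have hsub : Set.Icc m 1 ⊆ Set.Ioc 0 1 := fun p hp => ⟨hm0.trans_le hp.1, hp.2⟩
  have hcont : ContinuousOn Ψ (Set.Icc m 1) := by
    have hdiv : ContinuousOn (fun p => ξ / p) (Set.Icc m 1) :=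
      continuousOn_const.div continuousOn_id fun p hp => (hsub hp).1.ne'
    have hI := (continuousOn_integral_activity_div ha).comp hdiv fun p hp => hc p (hsub hp)
    rw [funext hΨ]
    exact (continuousOn_const.sub (continuousOn_const.mul hI)).rexp
  obtain ⟨p, hp, hfix⟩ := exists_mem_Icc_isFixedPt hcont hm1 (hle m ⟨hm0, hm1⟩) (hlt 1 h1).2.le
  exact ⟨p, hfix ▸ hlt p (hsub hp), hfix⟩
end

section
/- Let λ, r, θ, ρ > 0, ξ ∈ (0,1], α > 2. For v ≥ 0 and p ∈ (0,1] define Z(v,p) = ∫₀^{2π} min{ (ξ/p)·[1 + θ/(1 − 2v·cos ψ + v²)^{α/2}], 1 } dψ/(2π), and define Φ̂ : (0,1] → ℝ by Φ̂(p) = exp( −θ r^α/ρ − λ r² ∫₀^∞ ∫₀^{2π} Z(v,p) · v / (1 + (1 + v² − 2v·cos φ)^{α/2}/θ) dφ dv ). Then for every p ∈ (0,1] the double integral is finite, Φ̂ maps (0,1] into (0,1), and there exists p* ∈ (0,1) with Φ̂(p*) = p*, i.e., the fixed-point equation (9) of Theorem 1 admits a solution. -/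
open MeasureTheory Real

open Set

/-- Conditional activity probability of an interfering link seen at angle `ψ`. -/
noncomputable def activityProb (ξ θ α v p ψ : ℝ) : ℝ :=
  min ((ξ / p) * (1 + θ / (1 - 2 * v * Real.cos ψ + v ^ 2) ^ (α / 2))) 1

/-- Angular average of `activityProb`. -/
noncomputable def meanActivity (ξ θ α v p : ℝ) : ℝ :=
  (∫ ψ in Ioo (0:ℝ) (2 * π), activityProb ξ θ α v p ψ) / (2 * π)

/-- Weight of an interferer at polar position `(v, φ)`. -/
noncomputable def interferenceWeight (θ α v φ : ℝ) : ℝ :=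
  v / (1 + (1 + v ^ 2 - 2 * v * Real.cos φ) ^ (α / 2) / θ)

lemma sq_sub_one_le_sq_dist (v φ : ℝ) (hv : 0 ≤ v) :
    (v - 1) ^ 2 ≤ 1 + v ^ 2 - 2 * v * Real.cos φ := by
  nlinarith [mul_nonneg hv (sub_nonneg.2 (Real.cos_le_one φ))]

section Activity

variable {ξ θ α : ℝ}

lemma activityProb_mem_Icc (hξ : 0 < ξ) (hθ : 0 < θ) {v p : ℝ} (hv : 0 ≤ v) (hp : 0 < p) (ψ : ℝ) :
    activityProb ξ θ α v p ψ ∈ Icc (0:ℝ) 1 := by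
  have hD : 0 ≤ 1 - 2 * v * Real.cos ψ + v ^ 2 := by
    linarith [sq_sub_one_le_sq_dist v ψ hv, sq_nonneg (v - 1)]
  exact ⟨le_min (by positivity) zero_le_one, min_le_right _ _⟩

lemma measurable_activityProb (p : ℝ) :
    Measurable fun q : ℝ × ℝ => activityProb ξ θ α q.1 p q.2 := by
  unfold activityProb
  fun_prop

lemma volume_real_Ioo_two_pi : volume.real (Ioo (0:ℝ) (2 * π)) = 2 * π := by
  rw [Real.volume_real_Ioo_of_le (by positivity), sub_zero]

lemma meanActivity_mem_Icc (hξ : 0 < ξ) (hθ : 0 < θ) {v p : ℝ} (hv : 0 ≤ v) (hp : 0 < p) :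
    meanActivity ξ θ α v p ∈ Icc (0:ℝ) 1 := by
  have hb := activityProb_mem_Icc (α := α) hξ hθ hv hp
  refine ⟨div_nonneg (integral_nonneg fun ψ => (hb ψ).1) (by positivity), ?_⟩
  rw [meanActivity, div_le_one (by positivity)]
  have h := norm_setIntegral_le_of_norm_le_const (μ := volume) (s := Ioo (0:ℝ) (2 * π))
    (f := activityProb ξ θ α v p) (C := 1) measure_Ioo_lt_top
    (fun ψ _ => by rw [Real.norm_of_nonneg (hb ψ).1]; exact (hb ψ).2)
  rw [volume_real_Ioo_two_pi, one_mul] at h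
  exact (Real.le_norm_self _).trans h

lemma measurable_meanActivity (p : ℝ) : Measurable fun v => meanActivity ξ θ α v p := by
  have h : StronglyMeasurable fun q : ℝ × ℝ => activityProb ξ θ α q.1 p q.2 :=
    (measurable_activityProb p).stronglyMeasurable
  exact (h.integral_prod_right' (ν := volume.restrict (Ioo (0:ℝ) (2 * π)))).measurable.div_const _

lemma continuousOn_meanActivity (hξ : 0 < ξ) (hθ : 0 < θ) {v : ℝ} (hv : 0 ≤ v) :
    ContinuousOn (meanActivity ξ θ α v) (Ioi 0) := by
  refine ContinuousOn.div_const ?_ _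
  refine continuousOn_of_dominated (bound := fun _ => 1) (fun p _ => ?_) (fun p hp => ?_) ?_ ?_
  · exact ((measurable_activityProb p).comp measurable_prodMk_left).aestronglyMeasurable
  · refine .of_forall fun ψ => ?_
    have hb := activityProb_mem_Icc (α := α) hξ hθ hv hp ψ
    rw [Real.norm_of_nonneg hb.1]
    exact hb.2
  · exact integrableOn_const measure_Ioo_lt_top.ne
  · refine .of_forall fun ψ => ?_
    unfold activityProb
    have : ContinuousOn (fun p : ℝ => ξ / p) (Ioi 0) :=
      continuousOn_const.div continuousOn_id fun p hp => (mem_Ioi.1 hp).ne'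
    fun_prop

end Activity

section Weight

variable {θ α : ℝ}

lemma interferenceWeight_nonneg (hθ : 0 < θ) {v : ℝ} (hv : 0 ≤ v) (φ : ℝ) :
    0 ≤ interferenceWeight θ α v φ := by
  have hD := (sq_nonneg _).trans (sq_sub_one_le_sq_dist v φ hv)
  unfold interferenceWeight
  positivity

lemma one_add_rpow_le (hθ : 0 < θ) (hα : 0 < α) {v : ℝ} (hv : 0 ≤ v) :
    (1 + v) ^ α ≤ (4 ^ α + 2 ^ α * θ) * (1 + |v - 1| ^ α / θ) := by
  have hx := abs_nonneg (v - 1)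
  have h1 : 1 + v ≤ 2 + |v - 1| := by linarith [le_abs_self (v - 1)]
  have h2 : (1 + v) ^ α ≤ 4 ^ α + 2 ^ α * |v - 1| ^ α := by
    rcases le_total |v - 1| 2 with h | h
    · have : (1 + v) ^ α ≤ 4 ^ α := by gcongr; linarith
      have : 0 ≤ 2 ^ α * |v - 1| ^ α := by positivity
      linarith
    · have : (1 + v) ^ α ≤ (2 * |v - 1|) ^ α := by gcongr; linarith
      rw [mul_rpow zero_le_two hx] at this
      have : (0:ℝ) ≤ 4 ^ α := by positivity
      linarith
  have h3 : (4 ^ α + 2 ^ α * θ) * (1 + |v - 1| ^ α / θ) =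
      4 ^ α + 2 ^ α * |v - 1| ^ α + (2 ^ α * θ + 4 ^ α * (|v - 1| ^ α / θ)) := by
    field_simp
    ring
  have h4 : 0 ≤ 2 ^ α * θ + 4 ^ α * (|v - 1| ^ α / θ) := by positivity
  linarith

lemma interferenceWeight_le (hθ : 0 < θ) (hα : 0 < α) {v : ℝ} (hv : 0 ≤ v) (φ : ℝ) :
    interferenceWeight θ α v φ ≤ (4 ^ α + 2 ^ α * θ) * (1 + ‖v‖) ^ (-(α - 1)) := by
  have hpow : |v - 1| ^ α ≤ (1 + v ^ 2 - 2 * v * Real.cos φ) ^ (α / 2) := by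
    calc |v - 1| ^ α = ((v - 1) ^ 2) ^ (α / 2) := by
          rw [← sq_abs, ← rpow_natCast, ← rpow_mul (abs_nonneg _)]
          congr 1
          push_cast
          ring
      _ ≤ _ := rpow_le_rpow (sq_nonneg _) (sq_sub_one_le_sq_dist v φ hv) (by positivity)
  have hx : 0 ≤ |v - 1| ^ α := by positivity
  rw [Real.norm_of_nonneg hv]
  have hv1 : 0 < 1 + v := by linarith
  calc interferenceWeight θ α v φ ≤ (1 + v) / (1 + |v - 1| ^ α / θ) := by
        unfold interferenceWeight
        gcongr
        linarith
    _ ≤ _ := by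
        rw [div_le_iff₀ (by positivity)]
        calc 1 + v = (1 + v) ^ α * (1 + v) ^ (-(α - 1)) := by
              rw [← rpow_add hv1]
              ring_nf
              rw [rpow_one]
          _ ≤ (4 ^ α + 2 ^ α * θ) * (1 + |v - 1| ^ α / θ) * (1 + v) ^ (-(α - 1)) := by
              gcongr
              exact one_add_rpow_le hθ hα hv
          _ = _ := by ring

lemma measurable_interferenceWeight :
    Measurable fun q : ℝ × ℝ => interferenceWeight θ α q.1 q.2 := by
  unfold interferenceWeight
  fun_prop

lemma integrableOn_interferenceWeight (hθ : 0 < θ) (hα : 2 < α) :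
    IntegrableOn (fun q : ℝ × ℝ => interferenceWeight θ α q.1 q.2)
      (Ioi (0:ℝ) ×ˢ Ioo (0:ℝ) (2 * π)) := by
  have h1 : Integrable (fun v : ℝ => (1 + ‖v‖) ^ (-(α - 1))) (volume.restrict (Ioi 0)) :=
    (integrable_one_add_norm (by simp; linarith)).restrict
  have h2 : Integrable (fun _ : ℝ => (1:ℝ)) (volume.restrict (Ioo (0:ℝ) (2 * π))) :=
    integrableOn_const measure_Ioo_lt_top.ne
  have h3 := (h1.mul_prod h2).const_mul (4 ^ α + 2 ^ α * θ)
  rw [Measure.prod_restrict, ← Measure.volume_eq_prod] at h3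
  refine Integrable.mono' h3 measurable_interferenceWeight.aestronglyMeasurable ?_
  filter_upwards [ae_restrict_mem (measurableSet_Ioi.prod measurableSet_Ioo)] with q hq
  have hv : 0 ≤ q.1 := (mem_Ioi.1 hq.1).le
  rw [Real.norm_of_nonneg (interferenceWeight_nonneg hθ hv _), mul_one]
  exact interferenceWeight_le hθ (by linarith) hv _

end Weight

section Interference

variable {ξ θ α : ℝ}

lemma norm_meanActivity_mul_interferenceWeight_le (hξ : 0 < ξ) (hθ : 0 < θ) {p : ℝ} (hp : 0 < p) :
    ∀ᵐ q : ℝ × ℝ ∂volume.restrict (Ioi (0:ℝ) ×ˢ Ioo (0:ℝ) (2 * π)),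
      ‖meanActivity ξ θ α q.1 p * interferenceWeight θ α q.1 q.2‖
        ≤ interferenceWeight θ α q.1 q.2 := by
  filter_upwards [ae_restrict_mem (measurableSet_Ioi.prod measurableSet_Ioo)] with q hq
  have hv : 0 ≤ q.1 := (mem_Ioi.1 hq.1).le
  have hZ := meanActivity_mem_Icc (α := α) hξ hθ hv hp
  have hW := interferenceWeight_nonneg (α := α) hθ hv q.2
  rw [Real.norm_of_nonneg (mul_nonneg hZ.1 hW)]
  exact mul_le_of_le_one_left hW hZ.2

lemma measurable_meanActivity_mul_interferenceWeight (p : ℝ) :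
    Measurable fun q : ℝ × ℝ => meanActivity ξ θ α q.1 p * interferenceWeight θ α q.1 q.2 :=
  ((measurable_meanActivity p).comp measurable_fst).mul measurable_interferenceWeight

lemma integrableOn_meanActivity_mul_interferenceWeight (hξ : 0 < ξ) (hθ : 0 < θ) (hα : 2 < α)
    {p : ℝ} (hp : 0 < p) :
    IntegrableOn (fun q : ℝ × ℝ => meanActivity ξ θ α q.1 p * interferenceWeight θ α q.1 q.2)
      (Ioi (0:ℝ) ×ˢ Ioo (0:ℝ) (2 * π)) :=
  Integrable.mono' (integrableOn_interferenceWeight hθ hα)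
    (measurable_meanActivity_mul_interferenceWeight p).aestronglyMeasurable
    (norm_meanActivity_mul_interferenceWeight_le hξ hθ hp)

lemma continuousOn_integral_meanActivity_mul (hξ : 0 < ξ) (hθ : 0 < θ) (hα : 2 < α) :
    ContinuousOn (fun p => ∫ q in Ioi (0:ℝ) ×ˢ Ioo (0:ℝ) (2 * π),
      meanActivity ξ θ α q.1 p * interferenceWeight θ α q.1 q.2) (Ioi 0) := by
  refine continuousOn_of_dominated
    (fun p _ => (measurable_meanActivity_mul_interferenceWeight p).aestronglyMeasurable)
    (fun p hp => norm_meanActivity_mul_interferenceWeight_le hξ hθ hp)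
    (integrableOn_interferenceWeight hθ hα) ?_
  filter_upwards [ae_restrict_mem (measurableSet_Ioi.prod measurableSet_Ioo)] with q hq
  exact (continuousOn_meanActivity hξ hθ (mem_Ioi.1 hq.1).le).mul continuousOn_const

lemma integral_meanActivity_mul_mem_Icc (hξ : 0 < ξ) (hθ : 0 < θ) (hα : 2 < α)
    {p : ℝ} (hp : 0 < p) :
    ∫ q in Ioi (0:ℝ) ×ˢ Ioo (0:ℝ) (2 * π),
      meanActivity ξ θ α q.1 p * interferenceWeight θ α q.1 q.2 ∈
    Icc 0 (∫ q in Ioi (0:ℝ) ×ˢ Ioo (0:ℝ) (2 * π), interferenceWeight θ α q.1 q.2) := by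
  constructor
  · refine setIntegral_nonneg (measurableSet_Ioi.prod measurableSet_Ioo) fun q hq => ?_
    have hv : 0 ≤ q.1 := (mem_Ioi.1 hq.1).le
    exact mul_nonneg (meanActivity_mem_Icc hξ hθ hv hp).1 (interferenceWeight_nonneg hθ hv _)
  · refine integral_mono_ae (integrableOn_meanActivity_mul_interferenceWeight hξ hθ hα hp)
      (integrableOn_interferenceWeight hθ hα) ?_
    filter_upwards [norm_meanActivity_mul_interferenceWeight_le hξ hθ hp] with q hq
    exact (Real.le_norm_self _).trans hq

end Interference

/-- Theorem 1, equation (9): with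
`Z(v,p) = ∫₀^{2π} min{(ξ/p)[1 + θ/(1 − 2v cos ψ + v²)^{α/2}], 1} dψ/(2π)`,
the fixed-point equation
`p = exp(−θ r^α/ρ − λ r² ∫₀^∞ ∫₀^{2π} Z(v,p) v /(1 + (1 + v² − 2v cos φ)^{α/2}/θ) dφ dv)`
is well posed (the double integral is finite and the map sends `(0,1]` into `(0,1)`)
and admits a solution `p* ∈ (0,1)`. -/
theorem fixed_point_equation_exact
    (lam r θ ρ : ℝ) (hlam : 0 < lam) (hr : 0 < r) (hθ : 0 < θ) (hρ : 0 < ρ)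
    (ξ : ℝ) (hξ : ξ ∈ Set.Ioc (0:ℝ) 1) (α : ℝ) (hα : 2 < α)
    (Z : ℝ → ℝ → ℝ)
    (hZ : ∀ v p, Z v p =
      (∫ ψ in Set.Ioo (0:ℝ) (2 * π),
          min ((ξ / p) * (1 + θ / (1 - 2 * v * Real.cos ψ + v ^ 2) ^ (α / 2))) 1) / (2 * π))
    (Φhat : ℝ → ℝ)
    (hΦhat : ∀ p : ℝ, Φhat p = Real.exp (-(θ * r ^ α / ρ)
      - lam * r ^ 2 *
        ∫ v in Set.Ioi (0:ℝ), ∫ φ in Set.Ioo (0:ℝ) (2 * π),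
          Z v p * v / (1 + (1 + v ^ 2 - 2 * v * Real.cos φ) ^ (α / 2) / θ))) :
    (∀ p ∈ Set.Ioc (0:ℝ) 1,
        IntegrableOn
          (fun q : ℝ × ℝ =>
            Z q.1 p * q.1 / (1 + (1 + q.1 ^ 2 - 2 * q.1 * Real.cos q.2) ^ (α / 2) / θ))
          (Set.Ioi (0:ℝ) ×ˢ Set.Ioo (0:ℝ) (2 * π))) ∧
    (∀ p ∈ Set.Ioc (0:ℝ) 1, Φhat p ∈ Set.Ioo (0:ℝ) 1) ∧
    (∃ p ∈ Set.Ioo (0:ℝ) 1, Φhat p = p) := by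
  obtain rfl : Z = meanActivity ξ θ α := by
    funext v p
    exact hZ v p
  have hξ0 := hξ.1
  simp only [mul_div_assoc] at hΦhat ⊢
  have hint : ∀ p, 0 < p → IntegrableOn (fun q : ℝ × ℝ =>
      meanActivity ξ θ α q.1 p * interferenceWeight θ α q.1 q.2)
      (Set.Ioi (0:ℝ) ×ˢ Set.Ioo (0:ℝ) (2 * π)) := fun p hp =>
    integrableOn_meanActivity_mul_interferenceWeight hξ0 hθ hα hp
  set I : ℝ → ℝ := fun p => ∫ q in Set.Ioi (0:ℝ) ×ˢ Set.Ioo (0:ℝ) (2 * π),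
    meanActivity ξ θ α q.1 p * interferenceWeight θ α q.1 q.2 with hI
  set M : ℝ := ∫ q in Set.Ioi (0:ℝ) ×ˢ Set.Ioo (0:ℝ) (2 * π), interferenceWeight θ α q.1 q.2
  have hIM : ∀ p, 0 < p → I p ∈ Icc 0 M := fun p hp =>
    integral_meanActivity_mul_mem_Icc hξ0 hθ hα hp
  have hΦ : ∀ p, 0 < p → Φhat p = Real.exp (-(θ * r ^ α / ρ) - lam * r ^ 2 * I p) := by
    intro p hp
    have h := setIntegral_prod (μ := volume) (ν := volume) _ (hint p hp)
    rw [← Measure.volume_eq_prod] at h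
    rw [hΦhat, mul_div_assoc]
    simp only [hI]
    rw [h]
    rfl
  have hc : 0 < θ * r ^ α / ρ := by positivity
  have hk : 0 < lam * r ^ 2 := by positivity
  have hmem : ∀ p ∈ Set.Ioc (0:ℝ) 1, Φhat p ∈ Set.Ioo (0:ℝ) 1 := by
    intro p hp
    rw [hΦ p hp.1]
    refine ⟨Real.exp_pos _, Real.exp_lt_one_iff.2 ?_⟩
    linarith [mul_nonneg hk.le (hIM p hp.1).1]
  refine ⟨fun p hp => hint p hp.1, hmem, ?_⟩
  have hM : 0 ≤ M := (hIM 1 one_pos).1.trans (hIM 1 one_pos).2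
  set m : ℝ := Real.exp (-(θ * r ^ α / ρ) - lam * r ^ 2 * M)
  have hm0 : 0 < m := Real.exp_pos _
  have hm1 : m ≤ 1 := Real.exp_le_one_iff.2 (by linarith [mul_nonneg hk.le hM])
  have hcont : ContinuousOn Φhat (Icc m 1) := by
    have hIc : ContinuousOn I (Ioi 0) := continuousOn_integral_meanActivity_mul hξ0 hθ hα
    have h : ContinuousOn (fun p => Real.exp (-(θ * r ^ α / ρ) - lam * r ^ 2 * I p)) (Ioi 0) := by
      fun_prop
    exact (h.congr fun p hp => hΦ p hp).mono fun p hp => hm0.trans_le hp.1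
  obtain ⟨p, hp, hfix⟩ := exists_mem_Icc_isFixedPt hcont hm1
    (by
      rw [hΦ m hm0]
      exact Real.exp_le_exp.2
        (sub_le_sub_left (mul_le_mul_of_nonneg_left (hIM m hm0).2 hk.le) _))
    (hmem 1 ⟨one_pos, le_rfl⟩).2.le
  exact ⟨p, hfix ▸ hmem p ⟨hm0.trans_le hp.1, hp.2⟩, hfix⟩
end
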